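/- Let l > 0 and q₁, q₂ ∈ L^∞_loc((0, l], ℝ) with q₁(r) ≥ b/r² for some b > −1/4, and |q_j(r)| ≤ C/r² (j = 1,2) for some C > 0. Set B = b + 1/4 > 0. Then the ordinary differential equation y''(r) = (q₁(r) + i q₂(r)) y(r) on (0, l] admits a basis of (complex-valued) solutions (y₊, y₋) such that: for j = 0, 1, 2, |y₊^{(j)}(r)| ≤ A r^{1/2 + √B − j} for r near 0 and some A > 0; and there exist c, ε > 0 with |y₋(r)| ≥ c r^{1/2 − √B} for 0 < r < ε. -/

import Mathlib

open MeasureTheory Filter Complex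
open scoped ENNReal Topology

noncomputable section

theorem norm_integral_exp_smul_le {E : Type*} [NormedAddCommGroup E] [NormedSpace ℝ E]
    {g : ℝ → E} {L c t : ℝ} (hL : 0 < L) (ht : 0 ≤ t) (hc : 0 ≤ c) (hg : ∀ s, ‖g s‖ ≤ c) :
    ‖∫ s in (0 : ℝ)..t, Real.exp (L * s) • g s‖ ≤ Real.exp (L * t) * (c / L) := by
  have h1 : ‖∫ s in (0 : ℝ)..t, Real.exp (L * s) • g s‖
      ≤ ∫ s in (0 : ℝ)..t, Real.exp (L * s) * c := by
    refine intervalIntegral.norm_integral_le_of_norm_le ht ?_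
      (Continuous.intervalIntegrable (by fun_prop) _ _)
    refine Eventually.of_forall fun s _ => ?_
    rw [norm_smul, Real.norm_of_nonneg (Real.exp_pos _).le]
    gcongr
    exact hg s
  refine h1.trans ?_
  rw [intervalIntegral.integral_mul_const, intervalIntegral.integral_comp_mul_left _ hL.ne',
    integral_exp, smul_eq_mul, mul_zero, Real.exp_zero]
  calc L⁻¹ * (Real.exp (L * t) - 1) * c = (Real.exp (L * t) - 1) * (c / L) := by ring
    _ ≤ _ := by gcongr; linarith

/-- Linear Carathéodory equations with bounded measurable coefficients have global forward
solutions. -/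
theorem exists_integral_equation_solution {E : Type*} [NormedAddCommGroup E] [NormedSpace ℝ E]
    [CompleteSpace E] (A : ℝ → E →L[ℝ] E) (hA : StronglyMeasurable A) {k : ℝ}
    (hk : ∀ s, ‖A s‖ ≤ k) (z₀ : E) :
    ∃ z : ℝ → E, Continuous z ∧ ∀ t, 0 ≤ t → z t = z₀ + ∫ s in (0 : ℝ)..t, A s (z s) := by
  have hk0 : 0 ≤ k := (norm_nonneg _).trans (hk 0)
  set L : ℝ := 2 * k + 1 with hL
  have hLpos : 0 < L := by positivity
  have hbd (v : BoundedContinuousFunction ℝ E) (s : ℝ) : ‖A s (v s)‖ ≤ k * ‖v‖ :=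
    ((A s).le_opNorm _).trans (mul_le_mul (hk s) (v.norm_coe_le_norm s) (norm_nonneg _) hk0)
  have hmeas (v : ℝ → E) (hv : Continuous v) : StronglyMeasurable fun s => A s (v s) :=
    isBoundedBilinearMap_apply.continuous.comp_stronglyMeasurable
      (hA.prodMk hv.stronglyMeasurable)
  have hint (v : BoundedContinuousFunction ℝ E) (a b : ℝ) :
      IntervalIntegrable (fun s => Real.exp (L * s) • A s (v s)) volume a b := by
    have h1 : IntervalIntegrable (fun s => A s (v s)) volume a b := by
      refine (intervalIntegrable_const (c := k * ‖v‖)).mono_fun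
        (hmeas v v.continuous).aestronglyMeasurable ?_
      refine Eventually.of_forall fun s => (hbd v s).trans (le_abs_self _)
    exact h1.continuousOn_smul (by fun_prop)
  have hcont (v : BoundedContinuousFunction ℝ E) :
      Continuous fun t : ℝ => ∫ s in (0 : ℝ)..t, Real.exp (L * s) • A s (v s) :=
    intervalIntegral.continuous_primitive (hint v) 0
  let F (v : BoundedContinuousFunction ℝ E) (t : ℝ) : E :=
    Real.exp (-(L * max t 0)) • (z₀ + ∫ s in (0 : ℝ)..(max t 0), Real.exp (L * s) • A s (v s))
  have hFcont (v : BoundedContinuousFunction ℝ E) : Continuous (F v) := by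
    have h1 : Continuous fun t : ℝ => max t 0 := by fun_prop
    have h2 := (hcont v).comp h1
    exact (by fun_prop : Continuous fun t : ℝ => Real.exp (-(L * max t 0))).smul
      (continuous_const.add h2)
  have hFbd (v : BoundedContinuousFunction ℝ E) (t : ℝ) : ‖F v t‖ ≤ ‖z₀‖ + k * ‖v‖ / L := by
    have ht : 0 ≤ max t 0 := le_max_right _ _
    have h1 := norm_integral_exp_smul_le hLpos ht (by positivity) (hbd v)
    have h2 : Real.exp (-(L * max t 0)) ≤ 1 := by
      rw [Real.exp_le_one_iff]; have := mul_nonneg hLpos.le ht; linarith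
    simp only [F]
    rw [norm_smul, Real.norm_of_nonneg (Real.exp_pos _).le]
    calc _ ≤ Real.exp (-(L * max t 0)) *
          (‖z₀‖ + Real.exp (L * max t 0) * (k * ‖v‖ / L)) := by
          gcongr
          exact (norm_add_le _ _).trans (by gcongr)
      _ = Real.exp (-(L * max t 0)) * ‖z₀‖ + k * ‖v‖ / L := by
          rw [mul_add, ← mul_assoc, ← Real.exp_add]; simp
      _ ≤ _ := by
          gcongr
          exact mul_le_of_le_one_left (norm_nonneg _) h2
  let Φ (v : BoundedContinuousFunction ℝ E) : BoundedContinuousFunction ℝ E :=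
    BoundedContinuousFunction.ofNormedAddCommGroup (F v) (hFcont v) _ (hFbd v)
  have hΦ : ContractingWith (1 / 2) Φ := by
    refine ⟨by rw [← NNReal.coe_lt_coe]; norm_num, LipschitzWith.of_dist_le_mul fun v w => ?_⟩
    rw [BoundedContinuousFunction.dist_le (by positivity)]
    intro t
    have ht : 0 ≤ max t 0 := le_max_right _ _
    have h1 := norm_integral_exp_smul_le hLpos ht (by positivity) (hbd (v - w))
    have h2 : Φ v t - Φ w t = Real.exp (-(L * max t 0)) •
        ∫ s in (0 : ℝ)..(max t 0), Real.exp (L * s) • A s ((v - w) s) := by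
      simp only [Φ, F, BoundedContinuousFunction.coe_ofNormedAddCommGroup, ← smul_sub,
        add_sub_add_left_eq_sub]
      rw [← intervalIntegral.integral_sub (hint v _ _) (hint w _ _)]
      simp [smul_sub]
    rw [dist_eq_norm, h2, norm_smul, Real.norm_of_nonneg (Real.exp_pos _).le, dist_eq_norm]
    calc _ ≤ Real.exp (-(L * max t 0)) * (Real.exp (L * max t 0) * (k * ‖v - w‖ / L)) := by
          gcongr
      _ = k / L * ‖v - w‖ := by
          rw [← mul_assoc, ← Real.exp_add]; simp; ring
      _ ≤ _ := by
          gcongr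
          rw [div_le_iff₀ hLpos, hL]
          push_cast
          linarith
  set v := hΦ.fixedPoint Φ with hv
  have hfix : Φ v = v := hΦ.fixedPoint_isFixedPt
  refine ⟨fun t => Real.exp (L * t) • v t, by fun_prop, fun t ht => ?_⟩
  have h3 : v t = F v t := by
    conv_lhs => rw [← hfix]
    rfl
  simp only [map_smul]
  rw [h3]
  simp only [F, max_eq_left ht]
  rw [smul_smul, ← Real.exp_add]
  simp

theorem AbsolutelyContinuousOnInterval.le_of_ae_hasDerivAt_nonneg {f f' : ℝ → ℝ} {a b : ℝ}
    (hab : a ≤ b) (hf : AbsolutelyContinuousOnInterval f a b)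
    (hf' : ∀ᵐ t : ℝ, a < t → HasDerivAt f (f' t) t ∧ 0 ≤ f' t) : f a ≤ f b := by
  have h : 0 ≤ ∫ t in a..b, deriv f t := by
    refine intervalIntegral.integral_nonneg_of_ae_restrict hab ?_
    have hne : ∀ᵐ t : ℝ, t ≠ a := by simp [ae_iff, measure_singleton]
    filter_upwards [ae_restrict_mem measurableSet_Icc, ae_restrict_of_ae hf',
      ae_restrict_of_ae hne] with t ht h hta
    obtain ⟨h1, h2⟩ := h (lt_of_le_of_ne ht.1 (Ne.symm hta))
    simpa [h1.deriv] using h2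
  rw [hf.integral_deriv_eq_sub] at h
  linarith

theorem HasDerivAt.complex_re {f : ℝ → ℂ} {f' : ℂ} {t : ℝ} (h : HasDerivAt f f' t) :
    HasDerivAt (fun s => (f s).re) f'.re t :=
  Complex.reCLM.hasFDerivAt.comp_hasDerivAt t h

theorem HasDerivAt.complex_im {f : ℝ → ℂ} {f' : ℂ} {t : ℝ} (h : HasDerivAt f f' t) :
    HasDerivAt (fun s => (f s).im) f'.im t :=
  Complex.imCLM.hasFDerivAt.comp_hasDerivAt t h

theorem LipschitzOnWith.absolutelyContinuousOnInterval_re {f : ℝ → ℂ} {c : NNReal} {a b : ℝ}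
    (h : LipschitzOnWith c f (Set.uIcc a b)) :
    AbsolutelyContinuousOnInterval (fun t => (f t).re) a b :=
  (Complex.reCLM.lipschitz.comp_lipschitzOnWith h).absolutelyContinuousOnInterval

theorem LipschitzOnWith.absolutelyContinuousOnInterval_im {f : ℝ → ℂ} {c : NNReal} {a b : ℝ}
    (h : LipschitzOnWith c f (Set.uIcc a b)) :
    AbsolutelyContinuousOnInterval (fun t => (f t).im) a b :=
  (Complex.imCLM.lipschitz.comp_lipschitzOnWith h).absolutelyContinuousOnInterval

theorem exists_solution_secondOrder {V : ℝ → ℂ} (hV : Measurable V) {K : ℝ}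
    (hK : ∀ t, ‖V t‖ ≤ K) (u₀ w₀ : ℂ) :
    ∃ u w : ℝ → ℂ, Continuous u ∧ Continuous w ∧ u 0 = u₀ ∧ w 0 = w₀ ∧
      (∀ t, 0 < t → HasDerivAt u (w t) t) ∧
      (∀ᵐ t : ℝ, 0 < t → HasDerivAt w (V t * u t) t) ∧
      ∀ T, 0 ≤ T → ∃ c, LipschitzOnWith c u (Set.uIcc 0 T) ∧ LipschitzOnWith c w (Set.uIcc 0 T) := by
  have hK0 : 0 ≤ K := (norm_nonneg _).trans (hK 0)
  let P : ℂ × ℂ →L[ℝ] ℂ × ℂ :=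
    (ContinuousLinearMap.snd ℝ ℂ ℂ).prod 0
  let R : ℂ → (ℂ × ℂ →L[ℝ] ℂ × ℂ) := fun c =>
    c • ((ContinuousLinearMap.inr ℝ ℂ ℂ).comp (ContinuousLinearMap.fst ℝ ℂ ℂ))
  let A : ℝ → (ℂ × ℂ →L[ℝ] ℂ × ℂ) := fun s => P + R (V s)
  have hA (s : ℝ) (z : ℂ × ℂ) : A s z = (z.2, V s * z.1) := by
    simp [A, P, R]
  have hR : Continuous R := by fun_prop
  have hAm : StronglyMeasurable A :=
    stronglyMeasurable_const.add (hR.comp_stronglyMeasurable hV.stronglyMeasurable)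
  have hAn (s : ℝ) : ‖A s‖ ≤ max 1 K := by
    refine ContinuousLinearMap.opNorm_le_bound _ (by positivity) fun z => ?_
    rw [hA, Prod.norm_def]
    refine max_le ?_ ?_
    · exact (norm_snd_le z).trans (le_mul_of_one_le_left (norm_nonneg _) (le_max_left _ _))
    · rw [norm_mul]
      exact mul_le_mul ((hK s).trans (le_max_right _ _)) (norm_fst_le z) (norm_nonneg _)
        (by positivity)
  obtain ⟨z, hzc, hz⟩ := exists_integral_equation_solution A hAm hAn (u₀, w₀)
  have hAz : StronglyMeasurable fun s => A s (z s) :=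
    isBoundedBilinearMap_apply.continuous.comp_stronglyMeasurable
      (hAm.prodMk hzc.stronglyMeasurable)
  have hloc : LocallyIntegrable (fun s => A s (z s)) := by
    have h1 : LocallyIntegrable (fun s => max 1 K * ‖z s‖) :=
      (by fun_prop : Continuous fun s => max 1 K * ‖z s‖).locallyIntegrable
    refine h1.mono hAz.aestronglyMeasurable (Eventually.of_forall fun s => ?_)
    exact ((A s).le_of_opNorm_le (hAn s) _).trans (le_abs_self _)
  have hint (a b : ℝ) : IntervalIntegrable (fun s => A s (z s)) volume a b :=
    intervalIntegrable_iff.mpr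
      ((hloc.integrableOn_isCompact isCompact_uIcc).mono_set Set.uIoc_subset_uIcc)
  have hder : ∀ᵐ t : ℝ, 0 < t → HasDerivAt z (A t (z t)) t := by
    filter_upwards [LocallyIntegrable.ae_hasDerivAt_integral hloc] with t ht ht0
    refine ((ht 0).const_add (u₀, w₀)).congr_of_eventuallyEq ?_
    filter_upwards [lt_mem_nhds ht0] with s hs using hz s hs.le
  have hz1 (t : ℝ) (ht : 0 ≤ t) : (z t).1 = u₀ + ∫ s in (0 : ℝ)..t, (z s).2 := by
    have h := (ContinuousLinearMap.fst ℝ ℂ ℂ).intervalIntegral_comp_comm (hint 0 t)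
    rw [hz t ht, Prod.fst_add]
    congr 1
    simpa [hA] using h.symm
  refine ⟨fun t => (z t).1, fun t => (z t).2, by fun_prop, by fun_prop, ?_, ?_, ?_, ?_, ?_⟩
  · simp [hz 0 le_rfl]
  · simp [hz 0 le_rfl]
  · intro t ht
    have hc : Continuous fun s => (z s).2 := by fun_prop
    refine ((hc.integral_hasStrictDerivAt 0 t).hasDerivAt.const_add u₀).congr_of_eventuallyEq ?_
    filter_upwards [lt_mem_nhds ht] with s hs using hz1 s hs.le
  · filter_upwards [hder] with t ht ht0
    have := (ContinuousLinearMap.snd ℝ ℂ ℂ).hasFDerivAt.comp_hasDerivAt t (ht ht0)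
    simpa [hA, Function.comp_def] using this
  · intro T hT
    obtain ⟨c, hc⟩ := (isCompact_Icc (a := (0 : ℝ)) (b := T)).exists_bound_of_continuousOn
      hzc.continuousOn
    have hlip : LipschitzOnWith (Real.toNNReal (max 1 K * c)) z (Set.uIcc 0 T) := by
      refine LipschitzOnWith.of_dist_le_mul fun s hs t ht => ?_
      rw [Set.uIcc_of_le hT] at hs ht
      have hc0 : 0 ≤ c := (norm_nonneg _).trans (hc s hs)
      rw [dist_eq_norm, hz s hs.1, hz t ht.1, add_sub_add_left_eq_sub,
        intervalIntegral.integral_interval_sub_left (hint _ _) (hint _ _),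
        Real.coe_toNNReal _ (by positivity), Real.dist_eq]
      refine intervalIntegral.norm_integral_le_of_norm_le_const fun r hr => ?_
      refine (A r).le_of_opNorm_le_of_le (hAn r) (hc r ?_)
      have hr' := Set.uIoc_subset_uIcc hr
      have := Set.uIcc_subset_Icc ht hs hr'
      exact this
    exact ⟨_, by simpa [Function.comp_def] using LipschitzWith.prod_fst.comp_lipschitzOnWith hlip,
      by simpa [Function.comp_def] using LipschitzWith.prod_snd.comp_lipschitzOnWith hlip⟩

/-- Solutions of `u'' = V u` with `Re V ≥ μ²` on a half-line: one growing at least like `exp (μ t)`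
and one decaying at least like `exp (-μ t)`, with Wronskian `-1`. -/
theorem exists_growing_decaying_solutions {V : ℝ → ℂ} (hV : Measurable V) {K μ : ℝ}
    (hK : ∀ t, ‖V t‖ ≤ K) (hμ : 0 < μ) (hre : ∀ t, μ ^ 2 ≤ (V t).re) :
    ∃ u w up wp : ℝ → ℂ,
      (∀ t, 0 < t → HasDerivAt u (w t) t) ∧
      (∀ᵐ t : ℝ, 0 < t → HasDerivAt w (V t * u t) t) ∧
      (∀ t, 0 < t → HasDerivAt up (wp t) t) ∧
      (∀ᵐ t : ℝ, 0 < t → HasDerivAt wp (V t * up t) t) ∧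
      (∀ t, 0 < t → u t * wp t - up t * w t = -1) ∧
      (∀ t, 0 < t → Real.exp (μ * t) ≤ ‖u t‖) ∧
      ∃ A, 0 < A ∧ ∀ t, 0 < t →
        ‖up t‖ ≤ A * Real.exp (-(μ * t)) ∧ ‖wp t‖ ≤ A * Real.exp (-(μ * t)) := by
  obtain ⟨u, w, huc, hwc, hu0, hw0, hu, hw, hlip⟩ := exists_solution_secondOrder hV hK 1 μ
  have hKμ : μ ^ 2 ≤ K := (hre 0).trans ((Complex.re_le_norm _).trans (hK 0))
  have hKp : 0 < K := (pow_pos hμ 2).trans_le hKμ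
  have hVsq (t : ℝ) : (V t).re ^ 2 + (V t).im ^ 2 ≤ K ^ 2 := by
    have h := Complex.sq_norm (V t)
    rw [Complex.normSq_apply] at h
    have := pow_le_pow_left₀ (norm_nonneg _) (hK t) 2
    nlinarith
  have hacu (T : ℝ) (hT : 0 ≤ T) :
      AbsolutelyContinuousOnInterval (fun t => (u t).re) 0 T ∧
      AbsolutelyContinuousOnInterval (fun t => (u t).im) 0 T ∧
      AbsolutelyContinuousOnInterval (fun t => (w t).re) 0 T ∧
      AbsolutelyContinuousOnInterval (fun t => (w t).im) 0 T := by
    obtain ⟨c, h1, h2⟩ := hlip T hT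
    exact ⟨h1.absolutelyContinuousOnInterval_re, h1.absolutelyContinuousOnInterval_im,
      h2.absolutelyContinuousOnInterval_re, h2.absolutelyContinuousOnInterval_im⟩
  have hG (T : ℝ) (hT : 0 ≤ T) :
      μ * ((u T).re * (u T).re + (u T).im * (u T).im) ≤
        (u T).re * (w T).re + (u T).im * (w T).im := by
    obtain ⟨h1, h2, h3, h4⟩ := hacu T hT
    have hac := ((h1.mul h3).add (h2.mul h4)).sub
      (AbsolutelyContinuousOnInterval.const_mul μ ((h1.mul h1).add (h2.mul h2)))
    have h := hac.le_of_ae_hasDerivAt_nonneg hT (f' := fun t =>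
      ((w t).re * (w t).re + (u t).re * (V t * u t).re
        + ((w t).im * (w t).im + (u t).im * (V t * u t).im))
        - μ * (((w t).re * (u t).re + (u t).re * (w t).re)
          + ((w t).im * (u t).im + (u t).im * (w t).im))) (by
        filter_upwards [hw] with t ht ht0
        have d1 := (hu t ht0).complex_re
        have d2 := (hu t ht0).complex_im
        have d3 := (ht ht0).complex_re
        have d4 := (ht ht0).complex_im
        refine ⟨((d1.mul d3).add (d2.mul d4)).sub
          (((d1.mul d1).add (d2.mul d2)).const_mul μ), ?_⟩
        simp only [Complex.mul_re, Complex.mul_im]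
        have hr := hre t
        nlinarith [sq_nonneg ((w t).re - μ * (u t).re), sq_nonneg ((w t).im - μ * (u t).im),
          mul_nonneg (sub_nonneg.mpr hr) (sq_nonneg (u t).re),
          mul_nonneg (sub_nonneg.mpr hr) (sq_nonneg (u t).im)])
    simp [hu0, hw0] at h
    linarith
  have hmono : MonotoneOn (fun t => ‖u t‖ ^ 2 * Real.exp (-(2 * μ) * t)) (Set.Ici 0) := by
    have hsq : (fun t => ‖u t‖ ^ 2 * Real.exp (-(2 * μ) * t)) = fun t =>
        ((u t).re * (u t).re + (u t).im * (u t).im) * Real.exp (-(2 * μ) * t) := by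
      ext t
      rw [Complex.sq_norm, Complex.normSq_apply]
    rw [hsq]
    have hd (t : ℝ) (ht : 0 < t) := (((hu t ht).complex_re.mul (hu t ht).complex_re).add
      ((hu t ht).complex_im.mul (hu t ht).complex_im)).mul
      (((hasDerivAt_id t).const_mul (-(2 * μ))).exp)
    refine monotoneOn_of_deriv_nonneg (convex_Ici 0)
      (by fun_prop : Continuous _).continuousOn ?_ ?_
    · intro t ht
      rw [interior_Ici] at ht
      exact (hd t ht).differentiableAt.differentiableWithinAt
    · intro t ht
      rw [interior_Ici] at ht
      refine le_of_le_of_eq ?_ (hd t ht).deriv.symm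
      have := hG t (le_of_lt ht)
      have he := Real.exp_pos (-(2 * μ) * t)
      simp only [id, Pi.add_apply, Pi.mul_apply]
      have hh : 0 ≤ 2 * ((u t).re * (w t).re + (u t).im * (w t).im
        - μ * ((u t).re * (u t).re + (u t).im * (u t).im)) * Real.exp (-(2 * μ) * t) := by
        apply mul_nonneg _ he.le
        linarith
      refine hh.trans (le_of_eq ?_)
      ring
  have hgrow (s t : ℝ) (hs : 0 ≤ s) (hst : s ≤ t) :
      ‖u s‖ ^ 2 * Real.exp (2 * μ * (t - s)) ≤ ‖u t‖ ^ 2 := by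
    have h := hmono hs (hs.trans hst : (0 : ℝ) ≤ t) hst
    have h2 := mul_le_mul_of_nonneg_right h (Real.exp_pos (2 * μ * t)).le
    simp only [mul_assoc, ← Real.exp_add] at h2
    ring_nf at h2 ⊢
    simpa using h2
  have hexp (t : ℝ) (ht : 0 ≤ t) : Real.exp (μ * t) ≤ ‖u t‖ := by
    have h := hgrow 0 t le_rfl ht
    rw [hu0] at h
    refine le_of_sq_le_sq ?_ (norm_nonneg _)
    rw [← Real.exp_nat_mul]
    refine le_trans (le_of_eq ?_) h
    simp
    ring
  have hupos (t : ℝ) (ht : 0 ≤ t) : 0 < ‖u t‖ := (Real.exp_pos _).trans_le (hexp t ht)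
  have hw_le (T : ℝ) (hT : 0 ≤ T) : ‖w T‖ ≤ K / μ * ‖u T‖ := by
    obtain ⟨h1, h2, h3, h4⟩ := hacu T hT
    have hE : AbsolutelyContinuousOnInterval (fun t : ℝ => Real.exp (-μ * t)) 0 T :=
      ContDiffOn.absolutelyContinuousOnInterval (by fun_prop)
    have hac := ((AbsolutelyContinuousOnInterval.const_mul ((K / μ) ^ 2)
      ((h1.mul h1).add (h2.mul h2))).sub ((h3.mul h3).add (h4.mul h4))).mul hE
    have h := hac.le_of_ae_hasDerivAt_nonneg hT (f' := fun t =>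
      ((K / μ) ^ 2 * (((w t).re * (u t).re + (u t).re * (w t).re)
          + ((w t).im * (u t).im + (u t).im * (w t).im))
        - (((V t * u t).re * (w t).re + (w t).re * (V t * u t).re)
          + ((V t * u t).im * (w t).im + (w t).im * (V t * u t).im))) * Real.exp (-μ * t)
        + ((K / μ) ^ 2 * ((u t).re * (u t).re + (u t).im * (u t).im)
          - ((w t).re * (w t).re + (w t).im * (w t).im)) *
          (Real.exp (-μ * t) * (-μ * 1))) (by
        filter_upwards [hw] with t ht ht0
        have d1 := (hu t ht0).complex_re
        have d2 := (hu t ht0).complex_im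
        have d3 := (ht ht0).complex_re
        have d4 := (ht ht0).complex_im
        refine ⟨((((d1.mul d1).add (d2.mul d2)).const_mul ((K / μ) ^ 2)).sub
          ((d3.mul d3).add (d4.mul d4))).mul (((hasDerivAt_id t).const_mul (-μ)).exp), ?_⟩
        have hg := hG t ht0.le
        have hv := hVsq t
        simp only [Complex.mul_re, Complex.mul_im]
        generalize (u t).re = a at *
        generalize (u t).im = b at *
        generalize (w t).re = c at *
        generalize (w t).im = d at *
        generalize (V t).re = x at *
        generalize (V t).im = y at *
        have key : 0 ≤ μ * ((K / μ) ^ 2 * (2 * (a * c + b * d))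
            - 2 * ((x * a - y * b) * c + (x * b + y * a) * d)
            - μ * ((K / μ) ^ 2 * (a * a + b * b) - (c * c + d * d))) := by
          have e : μ * (K / μ) ^ 2 = K ^ 2 / μ := by field_simp
          have e2 : K ^ 2 / μ * (2 * (a * c + b * d)) ≥ 2 * K ^ 2 * (a * a + b * b) := by
            calc K ^ 2 / μ * (2 * (a * c + b * d))
                ≥ K ^ 2 / μ * (2 * (μ * (a * a + b * b))) := by gcongr
              _ = _ := by field_simp
          have e3 : μ ^ 2 * (K / μ) ^ 2 = K ^ 2 := by field_simp
          have e4 := mul_le_mul_of_nonneg_right hv (by positivity : 0 ≤ a ^ 2 + b ^ 2)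
          have e5 : μ * ((K / μ) ^ 2 * (2 * (a * c + b * d))
              - 2 * ((x * a - y * b) * c + (x * b + y * a) * d)
              - μ * ((K / μ) ^ 2 * (a * a + b * b) - (c * c + d * d)))
              = K ^ 2 / μ * (2 * (a * c + b * d))
                - 2 * μ * ((x * a - y * b) * c + (x * b + y * a) * d)
                - K ^ 2 * (a * a + b * b) + μ ^ 2 * (c * c + d * d) := by
            linear_combination (2 * (a * c + b * d)) * e - (a * a + b * b) * e3
          rw [e5]
          nlinarith [sq_nonneg (μ * c - (x * a - y * b)), sq_nonneg (μ * d - (x * b + y * a))]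
        have key2 := mul_nonneg (nonneg_of_mul_nonneg_right key hμ) (Real.exp_pos (-μ * t)).le
        refine key2.trans (le_of_eq ?_)
        ring)
    simp only [Pi.mul_apply, Pi.sub_apply, Pi.add_apply, hu0, hw0] at h
    simp only [Complex.one_re, Complex.one_im, Complex.ofReal_re, Complex.ofReal_im, mul_zero,
      mul_one, add_zero, Real.exp_zero] at h
    have hM : μ ≤ K / μ := by rw [le_div_iff₀ hμ]; nlinarith
    have h0 : 0 ≤ (K / μ) ^ 2 - μ * μ := by nlinarith
    have h5 := nonneg_of_mul_nonneg_left (h0.trans h) (Real.exp_pos (-μ * T))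
    refine le_of_sq_le_sq ?_ (by positivity)
    rw [mul_pow, Complex.sq_norm, Complex.sq_norm, Complex.normSq_apply, Complex.normSq_apply]
    linarith
  have hf_le (s t : ℝ) (hs : 0 ≤ s) (hst : s ≤ t) :
      ‖((u t) ^ 2)⁻¹‖ ≤ (‖u s‖ ^ 2)⁻¹ * Real.exp (2 * μ * s) * Real.exp (-(2 * μ) * t) := by
    have h := hgrow s t hs hst
    have hp := hupos s hs
    rw [norm_inv, norm_pow]
    refine (inv_anti₀ (by positivity) h).trans (le_of_eq ?_)
    rw [mul_inv, ← Real.exp_neg, mul_assoc _ (Real.exp _), ← Real.exp_add]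
    ring_nf
  have hfm : Measurable fun t => ((u t) ^ 2)⁻¹ := (huc.measurable.pow_const 2).inv
  have hneg : -(2 * μ) < 0 := by linarith
  have hfi (s : ℝ) (hs : 0 ≤ s) : IntegrableOn (fun t => ((u t) ^ 2)⁻¹) (Set.Ioi s) := by
    refine ((integrableOn_exp_mul_Ioi hneg s).const_mul
      ((‖u s‖ ^ 2)⁻¹ * Real.exp (2 * μ * s))).mono' hfm.aestronglyMeasurable ?_
    filter_upwards [ae_restrict_mem measurableSet_Ioi] with t ht using hf_le s t hs (le_of_lt ht)
  let I : ℝ → ℂ := fun t => ∫ s in Set.Ioi t, ((u s) ^ 2)⁻¹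
  have hI_le (t : ℝ) (ht : 0 ≤ t) : ‖I t‖ ≤ (‖u t‖ ^ 2)⁻¹ * (2 * μ)⁻¹ := by
    refine (norm_integral_le_of_norm_le ((integrableOn_exp_mul_Ioi hneg t).const_mul
      ((‖u t‖ ^ 2)⁻¹ * Real.exp (2 * μ * t))) ?_).trans (le_of_eq ?_)
    · filter_upwards [ae_restrict_mem measurableSet_Ioi] with s hs
        using hf_le t s ht (le_of_lt hs)
    · rw [integral_const_mul, integral_exp_mul_Ioi hneg, neg_div_neg_eq, mul_assoc,
        ← mul_div_assoc, ← Real.exp_add]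
      ring_nf
      simp
  have hI (t : ℝ) (ht : 0 < t) : HasDerivAt I (-((u t) ^ 2)⁻¹) t := by
    have hca : ContinuousAt (fun s => ((u s) ^ 2)⁻¹) t :=
      (huc.pow 2).continuousAt.inv₀ (pow_ne_zero 2 (norm_pos_iff.mp (hupos t ht.le)))
    have h1 := intervalIntegral.integral_hasDerivAt_right
      (intervalIntegrable_iff_integrableOn_Ioc_of_le ht.le |>.mpr
        ((hfi 0 le_rfl).mono_set Set.Ioc_subset_Ioi_self))
      hfm.stronglyMeasurable.stronglyMeasurableAtFilter hca
    refine (h1.const_sub (I 0)).congr_of_eventuallyEq ?_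
    filter_upwards [lt_mem_nhds ht] with s hs
    rw [eq_sub_iff_add_eq, add_comm]
    exact intervalIntegral.integral_interval_add_Ioi (hfi 0 le_rfl) (hfi s hs.le)
  refine ⟨u, w, fun t => u t * I t, fun t => w t * I t - (u t)⁻¹, hu, hw, ?_, ?_, ?_,
    fun t ht => hexp t ht.le, (K / μ + 1) * (2 * μ)⁻¹ + 1, by positivity, ?_⟩
  · intro t ht
    have hne : u t ≠ 0 := norm_pos_iff.mp (hupos t ht.le)
    refine ((hu t ht).mul (hI t ht)).congr_deriv ?_
    field_simp
    ring
  · filter_upwards [hw] with t ht ht0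
    have hne : u t ≠ 0 := norm_pos_iff.mp (hupos t ht0.le)
    refine (((ht ht0).mul (hI t ht0)).sub ((hu t ht0).inv hne)).congr_deriv ?_
    field_simp
    ring
  · intro t ht
    have hne : u t ≠ 0 := norm_pos_iff.mp (hupos t ht.le)
    field_simp
    ring
  · intro t ht
    have hp := hupos t ht.le
    have hinv : ‖u t‖⁻¹ ≤ Real.exp (-(μ * t)) := by
      rw [Real.exp_neg]
      exact inv_anti₀ (Real.exp_pos _) (hexp t ht.le)
    have hN : ‖u t‖ * ((‖u t‖ ^ 2)⁻¹ * (2 * μ)⁻¹) = (2 * μ)⁻¹ * ‖u t‖⁻¹ := by field_simp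
    have h1 : ‖u t * I t‖ ≤ (2 * μ)⁻¹ * ‖u t‖⁻¹ := by
      rw [norm_mul, ← hN]
      gcongr
      exact hI_le t ht.le
    have h2 : ‖w t * I t - (u t)⁻¹‖ ≤ K / μ * ((2 * μ)⁻¹ * ‖u t‖⁻¹) + ‖u t‖⁻¹ := by
      refine (norm_sub_le _ _).trans ?_
      rw [norm_inv, norm_mul, ← hN, ← mul_assoc (K / μ)]
      gcongr
      · exact hw_le t ht.le
      · exact hI_le t ht.le
    have hx : 0 ≤ ‖u t‖⁻¹ := by positivity
    have hy : 0 ≤ (2 * μ)⁻¹ := by positivity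
    have hz : 0 ≤ K / μ := by positivity
    have hA : 0 ≤ (K / μ + 1) * (2 * μ)⁻¹ + 1 := by positivity
    have h3 := mul_le_mul_of_nonneg_left hinv hA
    refine ⟨h1.trans (le_trans ?_ h3), h2.trans (le_trans ?_ h3)⟩
    · nlinarith [mul_nonneg (mul_nonneg hz hy) hx]
    · nlinarith [mul_nonneg hy hx]

/-- The Liouville change of variables `r = exp (R - t)`, `y r = r ^ (1/2) u t`, first derivative. -/
theorem hasDerivAt_liouville {u : ℝ → ℂ} {w : ℂ} {R r : ℝ} (hr : 0 < r)
    (hu : HasDerivAt u w (R - Real.log r)) :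
    HasDerivAt (fun s : ℝ => s ^ (1 / 2 : ℝ) • u (R - Real.log s))
      (r ^ (-(1 / 2) : ℝ) • ((1 / 2 : ℝ) • u (R - Real.log r) - w)) r := by
  have hT : HasDerivAt (fun s => R - Real.log s) (-r⁻¹) r :=
    (Real.hasDerivAt_log hr.ne').const_sub R
  have h1 := Real.hasDerivAt_rpow_const (p := (1 / 2 : ℝ)) (Or.inl hr.ne')
  refine (h1.smul (hu.scomp r hT)).congr_deriv ?_
  have e1 : r ^ ((1 / 2 : ℝ) - 1) = r ^ (-(1 / 2) : ℝ) := by norm_num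
  have e2 : r ^ (1 / 2 : ℝ) * r⁻¹ = r ^ (-(1 / 2) : ℝ) := by
    rw [← Real.rpow_neg_one, ← Real.rpow_add hr]; norm_num
  rw [e1, ← e2]
  simp only [Complex.real_smul, Function.comp_apply]
  push_cast
  ring

/-- The Liouville change of variables, second derivative. -/
theorem hasDerivAt_liouville_deriv {u w : ℝ → ℂ} {V : ℂ} {R r : ℝ} (hr : 0 < r)
    (hu : HasDerivAt u (w (R - Real.log r)) (R - Real.log r))
    (hw : HasDerivAt w (V * u (R - Real.log r)) (R - Real.log r)) :
    HasDerivAt (fun s : ℝ => s ^ (-(1 / 2) : ℝ) •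
        ((1 / 2 : ℝ) • u (R - Real.log s) - w (R - Real.log s)))
      ((V - 1 / 4) / (r : ℂ) ^ 2 * (r ^ (1 / 2 : ℝ) • u (R - Real.log r))) r := by
  have hT : HasDerivAt (fun s => R - Real.log s) (-r⁻¹) r :=
    (Real.hasDerivAt_log hr.ne').const_sub R
  have h1 := Real.hasDerivAt_rpow_const (p := (-(1 / 2) : ℝ)) (Or.inl hr.ne')
  refine (h1.smul (((hu.scomp r hT).const_smul (1 / 2 : ℝ)).sub (hw.scomp r hT))).congr_deriv ?_
  have e1 : r ^ ((-(1 / 2) : ℝ) - 1) = r ^ (1 / 2 : ℝ) * (r ^ 2)⁻¹ := by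
    rw [← Real.rpow_natCast, ← Real.rpow_neg hr.le, ← Real.rpow_add hr]; norm_num
  have e2 : r ^ (-(1 / 2) : ℝ) = r ^ (1 / 2 : ℝ) * r⁻¹ := by
    rw [← Real.rpow_neg_one, ← Real.rpow_add hr]; norm_num
  rw [e1, e2]
  have hrc : (r : ℂ) ≠ 0 := by exact_mod_cast hr.ne'
  simp only [Complex.real_smul, Function.comp_apply, Pi.sub_apply, Pi.smul_apply]
  push_cast
  field_simp
  ring

theorem ae_comp_sub_log {P : ℝ → Prop} (R : ℝ) (h : ∀ᵐ t : ℝ, P t) :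
    ∀ᵐ r : ℝ, 0 < r → P (R - Real.log r) := by
  rw [ae_iff] at h ⊢
  refine measure_mono_null (fun r hr => ?_)
    (addHaar_image_eq_zero_of_differentiableOn_of_addHaar_eq_zero volume
      (f := fun t => Real.exp (R - t)) (by fun_prop) h)
  simp only [Set.mem_ofPred_eq, Classical.not_imp] at hr
  exact ⟨_, hr.2, by simp [Real.exp_log hr.1]⟩

/-- **Lemma (behaviour of solutions of `y'' = (q₁ + iq₂)y` near an
inverse-square singularity)**: if `q₁(r) ≥ b/r²` with `b > -1/4`,
`|q_j(r)| ≤ C/r²` on `(0, l]`, and `B = b + 1/4 > 0`, then the ODE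
`y''(r) = (q₁(r) + iq₂(r))y(r)` on `(0, l]` admits a basis of solutions
`(y₊, y₋)` with `|y₊^{(j)}(r)| ≲ r^{1/2+√B-j}` (`j = 0,1,2`) near `0` and
`|y₋(r)| ≳ r^{1/2-√B}` near `0`. -/
theorem statement13 (l : ℝ) (hl : 0 < l) (q₁ q₂ : ℝ → ℝ)
    (hq₁m : Measurable q₁) (hq₂m : Measurable q₂)
    (b C : ℝ) (hb : -(1 / 4 : ℝ) < b) (hC : 0 < C)
    (hq₁ : ∀ r ∈ Set.Ioc (0 : ℝ) l, b / r ^ 2 ≤ q₁ r)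
    (hq : ∀ r ∈ Set.Ioc (0 : ℝ) l, |q₁ r| ≤ C / r ^ 2 ∧ |q₂ r| ≤ C / r ^ 2)
    (B : ℝ) (hB : B = b + 1 / 4) :
    ∃ yp ym yp' ym' : ℝ → ℂ,
      -- `y₊` is a solution (twice weakly differentiable, equation a.e.)
      (∀ r ∈ Set.Ioc (0 : ℝ) l, HasDerivAt yp (yp' r) r) ∧
      (∀ᵐ r : ℝ, r ∈ Set.Ioc (0 : ℝ) l →
        HasDerivAt yp' (((q₁ r : ℂ) + (q₂ r : ℂ) * Complex.I) * yp r) r) ∧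
      -- `y₋` is a solution
      (∀ r ∈ Set.Ioc (0 : ℝ) l, HasDerivAt ym (ym' r) r) ∧
      (∀ᵐ r : ℝ, r ∈ Set.Ioc (0 : ℝ) l →
        HasDerivAt ym' (((q₁ r : ℂ) + (q₂ r : ℂ) * Complex.I) * ym r) r) ∧
      -- linear independence: `(y₊, y₋)` is a basis of solutions
      (∀ c₁ c₂ : ℂ, (∀ r ∈ Set.Ioc (0 : ℝ) l, c₁ * yp r + c₂ * ym r = 0) →
        c₁ = 0 ∧ c₂ = 0) ∧
      -- upper bounds for `y₊`, `y₊'`, `y₊'' = (q₁+iq₂)y₊` near `0`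
      (∃ A ε : ℝ, 0 < A ∧ 0 < ε ∧ ∀ r ∈ Set.Ioc (0 : ℝ) (min ε l),
        ‖yp r‖ ≤ A * r ^ (1 / 2 + Real.sqrt B) ∧
        ‖yp' r‖ ≤ A * r ^ (Real.sqrt B - 1 / 2) ∧
        ‖((q₁ r : ℂ) + (q₂ r : ℂ) * Complex.I) * yp r‖ ≤ A * r ^ (Real.sqrt B - 3 / 2)) ∧
      -- lower bound for `y₋` near `0`
      (∃ c ε : ℝ, 0 < c ∧ 0 < ε ∧ ∀ r ∈ Set.Ioc (0 : ℝ) (min ε l),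
        c * r ^ (1 / 2 - Real.sqrt B) ≤ ‖ym r‖) := by
  set μ := Real.sqrt B with hμdef
  have hBpos : 0 < B := by linarith
  have hμ : 0 < μ := Real.sqrt_pos.mpr hBpos
  have hμsq : μ ^ 2 = B := Real.sq_sqrt hBpos.le
  set R := Real.log (2 * l) with hRdef
  have h2l : 0 < 2 * l := by linarith
  let q : ℝ → ℂ := fun r => (q₁ r : ℂ) + (q₂ r : ℂ) * Complex.I
  have hqm : Measurable q := by fun_prop
  let V : ℝ → ℂ := fun t =>
    if Real.exp (R - t) ≤ l then (Real.exp (R - t) : ℂ) ^ 2 * q (Real.exp (R - t)) + 1 / 4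
    else (B : ℂ)
  have hVm : Measurable V := by
    have he : Measurable fun t : ℝ => Real.exp (R - t) := by fun_prop
    refine Measurable.ite (measurableSet_le he measurable_const) ?_ measurable_const
    exact ((Complex.measurable_ofReal.comp he).pow_const 2 |>.mul (hqm.comp he)).add_const _
  have hqn (r : ℝ) (hr : r ∈ Set.Ioc (0 : ℝ) l) : ‖q r‖ ≤ 2 * C / r ^ 2 := by
    obtain ⟨h1, h2⟩ := hq r hr
    calc ‖q r‖ ≤ ‖(q₁ r : ℂ)‖ + ‖(q₂ r : ℂ) * Complex.I‖ := norm_add_le _ _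
      _ = |q₁ r| + |q₂ r| := by simp
      _ ≤ C / r ^ 2 + C / r ^ 2 := add_le_add h1 h2
      _ = _ := by ring
  have hVn (t : ℝ) : ‖V t‖ ≤ 2 * C + 1 / 4 + B := by
    simp only [V]
    split_ifs with h
    · have hp := Real.exp_pos (R - t)
      have h1 := hqn _ ⟨hp, h⟩
      rw [le_div_iff₀ (by positivity)] at h1
      have h2 := norm_add_le ((Real.exp (R - t) : ℂ) ^ 2 * q (Real.exp (R - t))) (1 / 4)
      rw [norm_mul, norm_pow, Complex.norm_real, Real.norm_of_nonneg hp.le] at h2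
      have h3 : ‖(1 / 4 : ℂ)‖ = 1 / 4 := by norm_num
      linarith
    · rw [Complex.norm_real, Real.norm_of_nonneg hBpos.le]
      linarith
  have hVre (t : ℝ) : μ ^ 2 ≤ (V t).re := by
    rw [hμsq]
    simp only [V]
    split_ifs with h
    · have hp := Real.exp_pos (R - t)
      have h1 := hq₁ _ ⟨hp, h⟩
      rw [div_le_iff₀ (by positivity)] at h1
      have h2 : ((Real.exp (R - t) : ℂ) ^ 2 * q (Real.exp (R - t)) + 1 / 4).re
          = Real.exp (R - t) ^ 2 * q₁ (Real.exp (R - t)) + 1 / 4 := by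
        rw [← Complex.ofReal_pow, Complex.add_re, Complex.re_ofReal_mul]
        simp [q]
      rw [h2, hB]
      linarith
    · simp
  have hVq (r : ℝ) (hr : r ∈ Set.Ioc (0 : ℝ) l) :
      (V (R - Real.log r) - 1 / 4) / (r : ℂ) ^ 2 = q r := by
    have hrc : (r : ℂ) ≠ 0 := by exact_mod_cast hr.1.ne'
    simp only [V, sub_sub_cancel, Real.exp_log hr.1, if_pos hr.2]
    field_simp
    ring
  have hT (r : ℝ) (hr : r ∈ Set.Ioc (0 : ℝ) l) : 0 < R - Real.log r :=
    sub_pos.mpr (Real.log_lt_log hr.1 (by linarith [hr.2]))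
  obtain ⟨u, w, up, wp, hu, hw, hup, hwp, hW, hlow, A, hA, hupp⟩ :=
    exists_growing_decaying_solutions hVm hVn hμ hVre
  have hder {f g : ℝ → ℂ} (hf : ∀ t, 0 < t → HasDerivAt f (g t) t) :
      ∀ r ∈ Set.Ioc (0 : ℝ) l, HasDerivAt (fun s : ℝ => s ^ (1 / 2 : ℝ) • f (R - Real.log s))
        (r ^ (-(1 / 2) : ℝ) • ((1 / 2 : ℝ) • f (R - Real.log r) - g (R - Real.log r))) r :=
    fun r hr => hasDerivAt_liouville hr.1 (hf _ (hT r hr))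
  have hder2 {f g : ℝ → ℂ} (hf : ∀ t, 0 < t → HasDerivAt f (g t) t)
      (hg : ∀ᵐ t : ℝ, 0 < t → HasDerivAt g (V t * f t) t) :
      ∀ᵐ r : ℝ, r ∈ Set.Ioc (0 : ℝ) l → HasDerivAt (fun s : ℝ => s ^ (-(1 / 2) : ℝ) •
        ((1 / 2 : ℝ) • f (R - Real.log s) - g (R - Real.log s)))
        (q r * (r ^ (1 / 2 : ℝ) • f (R - Real.log r))) r := by
    filter_upwards [ae_comp_sub_log R hg] with r h hr
    rw [← hVq r hr]
    exact hasDerivAt_liouville_deriv hr.1 (hf _ (hT r hr)) (h hr.1 (hT r hr))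
  refine ⟨fun r => r ^ (1 / 2 : ℝ) • up (R - Real.log r),
    fun r => r ^ (1 / 2 : ℝ) • u (R - Real.log r),
    fun r => r ^ (-(1 / 2) : ℝ) • ((1 / 2 : ℝ) • up (R - Real.log r) - wp (R - Real.log r)),
    fun r => r ^ (-(1 / 2) : ℝ) • ((1 / 2 : ℝ) • u (R - Real.log r) - w (R - Real.log r)),
    hder hup, hder2 hup hwp, hder hu, hder2 hu hw, ?_, ?_, ?_⟩
  · intro c₁ c₂ hc
    have hl2 : l / 2 ∈ Set.Ioc (0 : ℝ) l := ⟨by linarith, by linarith⟩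
    have h0 := hc _ hl2
    have hd := ((hder hup _ hl2).const_mul c₁).add ((hder hu _ hl2).const_mul c₂)
    have hz : HasDerivAt (fun _ : ℝ => (0 : ℂ)) 0 (l / 2) := hasDerivAt_const _ _
    have h1 := hd.unique (hz.congr_of_eventuallyEq (by
      filter_upwards [Ioc_mem_nhds hl2.1 (by linarith : l / 2 < l)] with r hr using hc r hr))
    have hWr := hW _ (hT _ hl2)
    have hpow : (((l / 2) ^ (1 / 2 : ℝ) : ℝ) : ℂ) * (((l / 2) ^ (-(1 / 2) : ℝ) : ℝ) : ℂ) = 1 := by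
      rw [← Complex.ofReal_mul, ← Real.rpow_add hl2.1]
      simp
    simp only [Complex.real_smul] at h0 h1
    generalize (((l / 2) ^ (1 / 2 : ℝ) : ℝ) : ℂ) = x at *
    generalize (((l / 2) ^ (-(1 / 2) : ℝ) : ℝ) : ℂ) = y at *
    generalize u (R - Real.log (l / 2)) = a at *
    generalize w (R - Real.log (l / 2)) = a' at *
    generalize up (R - Real.log (l / 2)) = d at *
    generalize wp (R - Real.log (l / 2)) = d' at *
    push_cast at h1
    constructor
    · linear_combination (x * a) * h1 - (y * (1 / 2 * a - a')) * h0 + (c₁ * x * y) * hWr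
        - c₁ * hpow
    · linear_combination (-(x * d)) * h1 + (y * (1 / 2 * d - d')) * h0 + (c₂ * x * y) * hWr
        - c₂ * hpow
  · have hk : 0 < Real.exp (-(μ * R)) := Real.exp_pos _
    refine ⟨A * Real.exp (-(μ * R)) * (2 + 2 * C), l, by positivity, hl, fun r hr => ?_⟩
    rw [min_self] at hr
    obtain ⟨h1, h2⟩ := hupp _ (hT r hr)
    have hexp : Real.exp (-(μ * (R - Real.log r))) = Real.exp (-(μ * R)) * r ^ μ := by
      rw [Real.rpow_def_of_pos hr.1, ← Real.exp_add]
      ring_nf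
    rw [hexp, ← mul_assoc] at h1 h2
    have hrμ : 0 < r ^ μ := Real.rpow_pos_of_pos hr.1 _
    have hD : 0 < A * Real.exp (-(μ * R)) := by positivity
    generalize A * Real.exp (-(μ * R)) = D at *
    have hy : ‖r ^ (1 / 2 : ℝ) • up (R - Real.log r)‖ ≤ D * r ^ (1 / 2 + μ) := by
      rw [norm_smul, Real.norm_of_nonneg (Real.rpow_nonneg hr.1.le _), Real.rpow_add hr.1]
      calc _ ≤ r ^ (1 / 2 : ℝ) * (D * r ^ μ) := by
            gcongr
            exact Real.rpow_nonneg hr.1.le _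
        _ = _ := by ring
    have hDC : 0 < D * C := by positivity
    refine ⟨hy.trans ?_, ?_, ?_⟩
    · refine mul_le_mul_of_nonneg_right ?_ (Real.rpow_nonneg hr.1.le _)
      linarith
    · have h3 : ‖(1 / 2 : ℝ) • up (R - Real.log r) - wp (R - Real.log r)‖
          ≤ 1 / 2 * (D * r ^ μ) + D * r ^ μ := by
        refine (norm_sub_le _ _).trans (add_le_add ?_ h2)
        rw [norm_smul, Real.norm_of_nonneg (by norm_num)]
        gcongr
      rw [norm_smul, Real.norm_of_nonneg (Real.rpow_nonneg hr.1.le _),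
        show μ - 1 / 2 = -(1 / 2) + μ by ring, Real.rpow_add hr.1]
      calc _ ≤ r ^ (-(1 / 2) : ℝ) * (1 / 2 * (D * r ^ μ) + D * r ^ μ) :=
            mul_le_mul_of_nonneg_left h3 (Real.rpow_nonneg hr.1.le _)
        _ = (D * (3 / 2)) * (r ^ (-(1 / 2) : ℝ) * r ^ μ) := by ring
        _ ≤ _ := by
            refine mul_le_mul_of_nonneg_right ?_
              (mul_nonneg (Real.rpow_nonneg hr.1.le _) hrμ.le)
            linarith
    · have hpow : r ^ (μ - 3 / 2) = r ^ (1 / 2 + μ) / r ^ 2 := by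
        rw [← Real.rpow_natCast, ← Real.rpow_sub hr.1]
        congr 1
        push_cast
        ring
      rw [norm_mul, hpow]
      calc _ ≤ 2 * C / r ^ 2 * (D * r ^ (1 / 2 + μ)) :=
            mul_le_mul (hqn r hr) hy (norm_nonneg _) (by positivity)
        _ = (D * (2 * C)) * (r ^ (1 / 2 + μ) / r ^ 2) := by ring
        _ ≤ _ := by
            refine mul_le_mul_of_nonneg_right ?_
              (div_nonneg (Real.rpow_nonneg hr.1.le _) (sq_nonneg r))
            linarith
  · refine ⟨Real.exp (μ * R), l, Real.exp_pos _, hl, fun r hr => ?_⟩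
    rw [min_self] at hr
    have hexp : Real.exp (μ * (R - Real.log r)) = Real.exp (μ * R) * r ^ (-μ) := by
      rw [Real.rpow_def_of_pos hr.1, ← Real.exp_add]
      ring_nf
    have h1 := hlow _ (hT r hr)
    rw [hexp] at h1
    rw [norm_smul, Real.norm_of_nonneg (Real.rpow_nonneg hr.1.le _), sub_eq_add_neg,
      Real.rpow_add hr.1]
    calc _ = r ^ (1 / 2 : ℝ) * (Real.exp (μ * R) * r ^ (-μ)) := by ring
      _ ≤ _ := mul_le_mul_of_nonneg_left h1 (Real.rpow_nonneg hr.1.le _)
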